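/- For every t ∈ ℝ, the quartic polynomial Γ₁(t) has four distinct complex roots, and the quartic polynomial Γ₂(t) has four distinct complex roots. -/

import Mathlib

open Polynomial

/-- The quartic `Γ₁(t)(X) = X⁴ − (16/3)X³ + (13/2 − (1/2)e^{2πit})X²
+ (3e^{2πit} − 3)X − 1/3`. -/
noncomputable def Gamma1 (t : ℝ) : Polynomial ℂ :=
  X ^ 4 - C (16 / 3 : ℂ) * X ^ 3
    + C ((13 / 2 : ℂ) - (1 / 2 : ℂ) * Complex.exp (2 * Real.pi * Complex.I * t)) * X ^ 2
    + C (3 * Complex.exp (2 * Real.pi * Complex.I * t) - 3) * X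
    - C (1 / 3 : ℂ)

/-- The quartic `Γ₂(t)(X) = X⁴ − (16/3)X³ + (8 − 2e^{2πit})X² − 1/3`. -/
noncomputable def Gamma2 (t : ℝ) : Polynomial ℂ :=
  X ^ 4 - C (16 / 3 : ℂ) * X ^ 3
    + C ((8 : ℂ) - 2 * Complex.exp (2 * Real.pi * Complex.I * t)) * X ^ 2
    - C (1 / 3 : ℂ)

/-- A polynomial over an algebraically closed field with no root in common with its derivative
has as many distinct roots as its degree. -/
lemma card_toFinset_roots_eq_natDegree {K : Type*} [Field K] [IsAlgClosed K] [DecidableEq K]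
    {p : K[X]} (hp : p ≠ 0) (h : ∀ x, p.eval x = 0 → p.derivative.eval x ≠ 0) :
    p.roots.toFinset.card = p.natDegree := by
  have hnodup : p.roots.Nodup := by
    rw [Multiset.nodup_iff_count_le_one]
    intro x
    rw [count_roots]
    by_contra! hx
    obtain ⟨h₀, h₁⟩ := (one_lt_rootMultiplicity_iff_isRoot hp).1 hx
    exact h x h₀ h₁
  rw [Multiset.toFinset_card_of_nodup hnodup]
  exact splits_iff_card_roots.1 (IsAlgClosed.splits p)

/-- A root on the unit circle of a real quartic is a root of the reversed quartic. -/
lemma reverse_quartic_eq_zero {a b c d e : ℝ} {y : ℂ} (hy : ‖y‖ = 1)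
    (h : a * y ^ 4 + b * y ^ 3 + c * y ^ 2 + d * y + e = 0) :
    e * y ^ 4 + d * y ^ 3 + c * y ^ 2 + b * y + a = 0 := by
  have hy₀ : y ≠ 0 := norm_ne_zero_iff.1 (by simp [hy])
  have hconj := congrArg (starRingEnd ℂ) h
  simp only [map_add, map_mul, map_pow, Complex.conj_ofReal, map_zero,
    ← Complex.inv_eq_conj hy] at hconj
  field_simp at hconj
  linear_combination hconj

lemma norm_eq_one_of_norm_sq_eq_one {y : ℂ} (h : ‖y ^ 2‖ = 1) : ‖y‖ = 1 := by
  rw [norm_pow] at h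
  exact (pow_eq_one_iff_of_nonneg (norm_nonneg y) two_ne_zero).1 h

lemma norm_exp_two_pi_I_mul (t : ℝ) : ‖Complex.exp (2 * Real.pi * Complex.I * t)‖ = 1 := by
  rw [← Complex.norm_exp_ofReal_mul_I (2 * Real.pi * t)]
  congr 2
  push_cast
  ring

lemma natDegree_Gamma1 (t : ℝ) : (Gamma1 t).natDegree = 4 := by
  unfold Gamma1
  compute_degree!

lemma natDegree_Gamma2 (t : ℝ) : (Gamma2 t).natDegree = 4 := by
  unfold Gamma2
  compute_degree!

lemma eval_derivative_Gamma1_ne_zero (t : ℝ) (x : ℂ) (h : (Gamma1 t).eval x = 0) :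
    (Gamma1 t).derivative.eval x ≠ 0 := by
  intro h'
  have hw := norm_exp_two_pi_I_mul t
  simp only [Gamma1] at h h'
  generalize Complex.exp (2 * Real.pi * Complex.I * t) = w at h h' hw
  simp at h h'
  have hfac : (x - 3) * ((2 * x - 1) ^ 2 - w) = 0 := by linear_combination h'
  rcases mul_eq_zero.1 hfac with hx | hx
  · obtain rfl : x = 3 := sub_eq_zero.1 hx
    have hw' : w = 83 / 27 := by linear_combination (2 / 9) * h
    norm_num [hw'] at hw
  · obtain rfl : (2 * x - 1) ^ 2 = w := sub_eq_zero.1 hx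
    obtain ⟨y, rfl⟩ : ∃ y, x = (y + 1) / 2 := ⟨2 * x - 1, by ring⟩
    have hy : ‖y‖ = 1 := by
      apply norm_eq_one_of_norm_sq_eq_one
      rw [← hw]
      ring_nf
    have hf : (-3 : ℝ) * y ^ 4 + (40 : ℝ) * y ^ 3 + (66 : ℝ) * y ^ 2 + (0 : ℝ) * y
        + (-39 : ℝ) = 0 := by
      push_cast
      linear_combination 48 * h
    have hr := reverse_quartic_eq_zero hy hf
    push_cast at hf hr
    have : (620544 : ℂ) = 0 := by
      linear_combination (-15991 + 465 * y - 18837 * y ^ 2 + 17355 * y ^ 3) * hf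
        + (1035 + 7755 * y + 19249 * y ^ 2 - 1335 * y ^ 3) * hr
    norm_num at this

lemma eval_derivative_Gamma2_ne_zero (t : ℝ) (x : ℂ) (h : (Gamma2 t).eval x = 0) :
    (Gamma2 t).derivative.eval x ≠ 0 := by
  intro h'
  have hw := norm_exp_two_pi_I_mul t
  simp only [Gamma2] at h h'
  generalize Complex.exp (2 * Real.pi * Complex.I * t) = w at h h' hw
  simp at h h'
  have hfac : x * ((x - 2) ^ 2 - w) = 0 := by linear_combination (1 / 4) * h'
  rcases mul_eq_zero.1 hfac with rfl | hx
  · norm_num at h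
  · obtain rfl : (x - 2) ^ 2 = w := sub_eq_zero.1 hx
    obtain ⟨y, rfl⟩ : ∃ y, x = y + 2 := ⟨x - 2, by ring⟩
    have hy : ‖y‖ = 1 := by
      apply norm_eq_one_of_norm_sq_eq_one
      rw [← hw]
      ring_nf
    have hf : (3 : ℝ) * y ^ 4 + (16 : ℝ) * y ^ 3 + (24 : ℝ) * y ^ 2 + (0 : ℝ) * y
        + (-15 : ℝ) = 0 := by
      push_cast
      linear_combination -3 * h
    have hr := reverse_quartic_eq_zero hy hf
    push_cast at hf hr
    have : (27384 : ℂ) = 0 := by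
      linear_combination (-1975 - 438 * y - 2070 * y ^ 2 + 2130 * y ^ 3) * hf
        + (-747 + 1794 * y + 1858 * y ^ 2 + 426 * y ^ 3) * hr
    norm_num at this

/-- for every real `t`, the quartics `Γ₁(t)` and `Γ₂(t)` each
have four distinct complex roots. -/
theorem stmt_11 (t : ℝ) :
    (Gamma1 t).roots.toFinset.card = 4 ∧ (Gamma2 t).roots.toFinset.card = 4 := by
  constructor
  · rw [← natDegree_Gamma1 t]
    exact card_toFinset_roots_eq_natDegree
      (ne_zero_of_natDegree_gt (n := 0) (by simp [natDegree_Gamma1]))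
      (eval_derivative_Gamma1_ne_zero t)
  · rw [← natDegree_Gamma2 t]
    exact card_toFinset_roots_eq_natDegree
      (ne_zero_of_natDegree_gt (n := 0) (by simp [natDegree_Gamma2]))
      (eval_derivative_Gamma2_ne_zero t)
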